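/- The function x ↦ log ρ(x) = Ψ(x) − x²/2 − (1/2)log(2π) is strictly concave and strictly increasing on ℝ; equivalently, x ↦ Ψ(x) − x²/2 is strictly concave and strictly increasing on ℝ, where Ψ(x) = −log Φ̄(x). -/

import Mathlib

/-- Standard normal density. -/
noncomputable def stdPhi (x : ℝ) : ℝ := Real.exp (-x ^ 2 / 2) / Real.sqrt (2 * Real.pi)

/-- Standard normal upper-tail probability. -/
noncomputable def phiBar (x : ℝ) : ℝ := ∫ t in Set.Ioi x, stdPhi t

/-- Standard normal hazard rate. -/
noncomputable def rho (x : ℝ) : ℝ := stdPhi x / phiBar x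

/-- The difference r(x) = ρ(x) − x. -/
noncomputable def rFun (x : ℝ) : ℝ := rho x - x

/-- Ψ(x) = −log Φ̄(x). -/
noncomputable def Psi (x : ℝ) : ℝ := -Real.log (phiBar x)

open Filter Topology in
/-- A function with negative derivative on `[a, ∞)` that tends to `0` at infinity is positive
at `a`. -/
lemma pos_of_hasDerivAt_neg_of_tendsto_zero {f f' : ℝ → ℝ} {a : ℝ}
    (hf : ∀ x, a ≤ x → HasDerivAt f (f' x) x) (hf' : ∀ x, a ≤ x → f' x < 0)
    (hlim : Tendsto f atTop (𝓝 0)) : 0 < f a := by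
  have hanti : StrictAntiOn f (Set.Ici a) := by
    refine strictAntiOn_of_deriv_neg (convex_Ici a)
      (fun x hx => (hf x hx).continuousAt.continuousWithinAt) fun x hx => ?_
    rw [interior_Ici] at hx
    rw [(hf x (le_of_lt hx)).deriv]
    exact hf' x (le_of_lt hx)
  have h1 : f (a + 1) < f a := hanti (by simp) (by simp) (by linarith)
  have h2 : 0 ≤ f (a + 1) := by
    refine le_of_tendsto hlim ?_
    filter_upwards [eventually_ge_atTop (a + 1)] with x hx
    exact hanti.antitoneOn (by simp) (by simp only [Set.mem_Ici]; linarith) hx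
  linarith

lemma stdPhi_pos (x : ℝ) : 0 < stdPhi x := by
  unfold stdPhi
  positivity

lemma continuous_stdPhi : Continuous stdPhi := by
  unfold stdPhi
  fun_prop

lemma integrable_stdPhi : MeasureTheory.Integrable stdPhi := by
  have h := (integrable_exp_neg_mul_sq (b := 1 / 2) (by norm_num)).div_const
    (Real.sqrt (2 * Real.pi))
  refine h.congr (Filter.Eventually.of_forall fun x => ?_)
  simp only [stdPhi]
  ring_nf

lemma hasDerivAt_stdPhi (x : ℝ) : HasDerivAt stdPhi (-x * stdPhi x) x := by
  have h : HasDerivAt (fun y : ℝ => -y ^ 2 / 2) (-x) x := by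
    refine ((hasDerivAt_pow 2 x).neg.div_const 2).congr_deriv ?_
    norm_num
    ring
  refine (h.exp.div_const (Real.sqrt (2 * Real.pi))).congr_deriv ?_
  rw [stdPhi]
  ring

open Filter Topology in
lemma tendsto_stdPhi_atTop : Tendsto stdPhi atTop (𝓝 0) := by
  have h : Tendsto (fun x : ℝ => -x ^ 2 / 2) atTop atBot := by
    have := (tendsto_pow_atTop (α := ℝ) (n := 2) (by norm_num)).atTop_div_const
      (r := 2) (by norm_num)
    refine (tendsto_neg_atTop_atBot.comp this).congr fun x => ?_
    simp only [Function.comp]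
    ring
  have h' := (Real.tendsto_exp_atBot.comp h).div_const (Real.sqrt (2 * Real.pi))
  rw [zero_div] at h'
  exact h'

lemma phiBar_eq_sub (x : ℝ) : phiBar x = phiBar 0 - ∫ t in (0 : ℝ)..x, stdPhi t := by
  have := intervalIntegral.integral_Ioi_sub_Ioi' (a := 0) (b := x) (f := stdPhi)
    (μ := MeasureTheory.volume) integrable_stdPhi.integrableOn integrable_stdPhi.integrableOn
  unfold phiBar
  linarith

lemma hasDerivAt_phiBar (x : ℝ) : HasDerivAt phiBar (-stdPhi x) x := by
  have h := (continuous_stdPhi.integral_hasStrictDerivAt 0 x).hasDerivAt.const_sub (phiBar 0)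
  exact h.congr_of_eventuallyEq (Filter.Eventually.of_forall phiBar_eq_sub)

open Filter Topology in
lemma tendsto_phiBar_atTop : Tendsto phiBar atTop (𝓝 0) := by
  have h := (MeasureTheory.intervalIntegral_tendsto_integral_Ioi 0
    integrable_stdPhi.integrableOn tendsto_id).const_sub (phiBar 0)
  have h0 : phiBar 0 - ∫ t in Set.Ioi (0 : ℝ), stdPhi t = 0 := sub_self _
  rw [h0] at h
  exact h.congr fun x => (phiBar_eq_sub x).symm

lemma phiBar_pos (x : ℝ) : 0 < phiBar x :=
  pos_of_hasDerivAt_neg_of_tendsto_zero (fun y _ => hasDerivAt_phiBar y)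
    (fun y _ => neg_neg_of_pos (stdPhi_pos y)) tendsto_phiBar_atTop

open Filter Topology in
/-- Gordon's upper bound for the Mills ratio. -/
lemma mul_phiBar_lt_stdPhi (x : ℝ) : x * phiBar x < stdPhi x := by
  rcases le_or_gt x 0 with hx | hx
  · exact (mul_nonpos_of_nonpos_of_nonneg hx (phiBar_pos x).le).trans_lt (stdPhi_pos x)
  have h : 0 < stdPhi x / x - phiBar x := by
    refine pos_of_hasDerivAt_neg_of_tendsto_zero (f := fun y => stdPhi y / y - phiBar y)
      (f' := fun y => -(stdPhi y / y ^ 2)) (fun y hy => ?_) (fun y hy => ?_) ?_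
    · have hy0 : y ≠ 0 := (hx.trans_le hy).ne'
      refine (((hasDerivAt_stdPhi y).div (hasDerivAt_id y) hy0).sub
        (hasDerivAt_phiBar y)).congr_deriv ?_
      simp only [id]
      field_simp
      ring
    · have hy0 : 0 < y := hx.trans_le hy
      have := stdPhi_pos y
      simp only [neg_lt_zero]
      positivity
    · simpa using (tendsto_stdPhi_atTop.div_atTop tendsto_id).sub tendsto_phiBar_atTop
  have h' : phiBar x < stdPhi x / x := by linarith
  rw [lt_div_iff₀ hx] at h'
  linarith

lemma abs_lt_sqrt_sq_add_four (x : ℝ) : |x| < Real.sqrt (x ^ 2 + 4) := by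
  rw [← Real.sqrt_sq_eq_abs]
  exact Real.sqrt_lt_sqrt (sq_nonneg x) (by linarith)

open Filter Topology in
/-- Birnbaum's lower bound for the Mills ratio. -/
lemma stdPhi_mul_lt_phiBar (x : ℝ) :
    stdPhi x * ((Real.sqrt (x ^ 2 + 4) - x) / 2) < phiBar x := by
  rw [← sub_pos]
  refine pos_of_hasDerivAt_neg_of_tendsto_zero
    (f := fun y => phiBar y - stdPhi y * ((Real.sqrt (y ^ 2 + 4) - y) / 2))
    (f' := fun y => -stdPhi y - (-y * stdPhi y * ((Real.sqrt (y ^ 2 + 4) - y) / 2) +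
      stdPhi y * ((y / Real.sqrt (y ^ 2 + 4) - 1) / 2))) (fun y _ => ?_) (fun y _ => ?_) ?_
  · have h1 : HasDerivAt (fun z : ℝ => Real.sqrt (z ^ 2 + 4)) (y / Real.sqrt (y ^ 2 + 4)) y := by
      convert ((hasDerivAt_pow 2 y).add_const 4).sqrt (by positivity) using 1
      field_simp
      norm_num
      ring
    exact (hasDerivAt_phiBar y).sub ((hasDerivAt_stdPhi y).mul
      ((h1.sub (hasDerivAt_id y)).div_const 2))
  · have hs : 0 < Real.sqrt (y ^ 2 + 4) := by positivity
    have hs2 : Real.sqrt (y ^ 2 + 4) ^ 2 = y ^ 2 + 4 := Real.sq_sqrt (by positivity)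
    set s := Real.sqrt (y ^ 2 + 4)
    have key : y ^ 3 + 3 * y < s * (y ^ 2 + 1) := by
      refine lt_of_pow_lt_pow_left₀ 2 (by positivity) ?_
      rw [mul_pow, hs2]
      linarith [show (y ^ 2 + 4) * (y ^ 2 + 1) ^ 2 = (y ^ 3 + 3 * y) ^ 2 + 4 by ring]
    have e : -stdPhi y - (-y * stdPhi y * ((s - y) / 2) + stdPhi y * ((y / s - 1) / 2)) =
        -(stdPhi y * (s * (y ^ 2 + 1) - (y ^ 3 + 3 * y)) / (2 * s)) := by
      field_simp
      linear_combination stdPhi y * y * hs2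
    simp only [e, neg_lt_zero]
    have := stdPhi_pos y
    have := sub_pos.2 key
    positivity
  · have h : Tendsto (fun y => stdPhi y * ((Real.sqrt (y ^ 2 + 4) - y) / 2)) atTop (𝓝 0) := by
      refine squeeze_zero' (Eventually.of_forall fun y => ?_) ?_ tendsto_stdPhi_atTop
      · have := (le_abs_self y).trans_lt (abs_lt_sqrt_sq_add_four y)
        exact mul_nonneg (stdPhi_pos y).le (by linarith)
      · filter_upwards [eventually_ge_atTop 0] with y hy
        have : Real.sqrt (y ^ 2 + 4) ≤ y + 2 := Real.sqrt_le_iff.2 ⟨by linarith, by nlinarith⟩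
        exact mul_le_of_le_one_right (stdPhi_pos y).le (by linarith)
    simpa using tendsto_phiBar_atTop.sub h

lemma rFun_pos (x : ℝ) : 0 < rFun x := by
  rw [rFun, sub_pos, rho, lt_div_iff₀ (phiBar_pos x)]
  exact mul_phiBar_lt_stdPhi x

lemma hasDerivAt_rFun (x : ℝ) :
    HasDerivAt rFun
      (-(phiBar x ^ 2 + x * stdPhi x * phiBar x - stdPhi x ^ 2) / phiBar x ^ 2) x := by
  have h0 := (phiBar_pos x).ne'
  refine (((hasDerivAt_stdPhi x).div (hasDerivAt_phiBar x) h0).sub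
    (hasDerivAt_id x)).congr_deriv ?_
  field_simp
  ring

lemma strictAnti_rFun : StrictAnti rFun := by
  refine strictAnti_of_deriv_neg fun x => ?_
  rw [(hasDerivAt_rFun x).deriv]
  have hs2 : Real.sqrt (x ^ 2 + 4) ^ 2 = x ^ 2 + 4 := Real.sq_sqrt (by positivity)
  have hlow := stdPhi_mul_lt_phiBar x
  have hsx := (neg_le_abs x).trans_lt (abs_lt_sqrt_sq_add_four x)
  set s := Real.sqrt (x ^ 2 + 4)
  have hφ := stdPhi_pos x
  have hΦ := phiBar_pos x
  have e : phiBar x ^ 2 + x * stdPhi x * phiBar x - stdPhi x ^ 2 =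
      (phiBar x - stdPhi x * ((s - x) / 2)) * (phiBar x + stdPhi x * ((s + x) / 2)) := by
    linear_combination (stdPhi x ^ 2 / 4) * hs2
  have h1 : 0 < phiBar x - stdPhi x * ((s - x) / 2) := sub_pos.2 hlow
  have h2 : 0 < (s + x) / 2 := by linarith
  rw [e, neg_div, neg_lt_zero]
  positivity

lemma hasDerivAt_Psi_sub (x : ℝ) : HasDerivAt (fun y => Psi y - y ^ 2 / 2) (rFun x) x := by
  refine (((hasDerivAt_phiBar x).log (phiBar_pos x).ne').neg.sub
    ((hasDerivAt_pow 2 x).div_const 2)).congr_deriv ?_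
  simp only [rFun, rho]
  norm_num
  ring

lemma log_rho_eq (x : ℝ) :
    Real.log (rho x) = Psi x - x ^ 2 / 2 - (1 / 2) * Real.log (2 * Real.pi) := by
  rw [rho, Real.log_div (stdPhi_pos x).ne' (phiBar_pos x).ne', stdPhi,
    Real.log_div (Real.exp_pos _).ne' (by positivity), Real.log_exp,
    Real.log_sqrt (by positivity), Psi]
  ring

theorem log_rho_strictConcave_strictMono :
    (∀ x : ℝ, Real.log (rho x) = Psi x - x ^ 2 / 2 - (1 / 2) * Real.log (2 * Real.pi)) ∧
    StrictConcaveOn ℝ Set.univ (fun x => Real.log (rho x)) ∧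
    StrictMono (fun x => Real.log (rho x)) ∧
    StrictConcaveOn ℝ Set.univ (fun x => Psi x - x ^ 2 / 2) ∧
    StrictMono (fun x => Psi x - x ^ 2 / 2) := by
  have hderiv : deriv (fun x => Psi x - x ^ 2 / 2) = rFun :=
    funext fun x => (hasDerivAt_Psi_sub x).deriv
  have hconc : StrictConcaveOn ℝ Set.univ (fun x => Psi x - x ^ 2 / 2) :=
    StrictAnti.strictConcaveOn_univ_of_deriv
      (continuous_iff_continuousAt.2 fun x => (hasDerivAt_Psi_sub x).continuousAt)
      (hderiv ▸ strictAnti_rFun)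
  have hmono : StrictMono (fun x => Psi x - x ^ 2 / 2) :=
    strictMono_of_deriv_pos fun x => hderiv ▸ rFun_pos x
  refine ⟨log_rho_eq, ?_, ?_, hconc, hmono⟩
  · simp only [log_rho_eq, sub_eq_add_neg _ (1 / 2 * Real.log (2 * Real.pi))]
    exact hconc.add_const _
  · simp only [log_rho_eq]
    exact fun x y hxy => sub_lt_sub_right (hmono hxy) _
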